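/- Let (C, D, η) be an anti-involutive category. Then the Hermitian category Herm(C), with objects the Hermitian objects (x, h), morphisms from (x,h) to (y,k) the morphisms x ⟶ y of C, and with the operation sending f : (x,h) ⟶ (y,k) to f‡ := h ∘ f† ∘ k⁻¹ : y ⟶ x, is a dagger category: (𝟙)‡ = 𝟙, (f ≫ g)‡ = g‡ ≫ f‡, and (f‡)‡ = f for all morphisms f, g of Herm(C). In particular the dagger ‡ is the identity on objects. -/

import Mathlib

open CategoryTheory Opposite

universe v u

/-- An anti-involutive category: a category `C` equipped with a functor `D : C ⥤ Cᵒᵖ`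
and a natural isomorphism `η` with components `η x : x†† ≅ x` (where `x† = (D.obj x).unop`
and `f† = (D.map f).unop`), satisfying the coherence condition `η (x†) = ((η x)†)⁻¹`. -/
structure AntiInvCat (C : Type u) [Category.{v} C] where
  /-- The anti-involution functor. -/
  D : C ⥤ Cᵒᵖ
  /-- The components `η x : x†† ≅ x` of the natural isomorphism. -/
  η : ∀ x : C, (D.obj ((D.obj x).unop)).unop ≅ x
  /-- Naturality: `f ∘ η x = η y ∘ f††` for `f : x ⟶ y`. -/
  η_nat : ∀ {x y : C} (f : x ⟶ y),
    (η x).hom ≫ f = (D.map ((D.map f).unop)).unop ≫ (η y).hom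
  /-- Coherence: `η (x†) = ((η x)†)⁻¹`, expressed as `η (x†) ≫ (η x)† = 𝟙`. -/
  η_coh : ∀ x : C,
    (η ((D.obj x).unop)).hom ≫ (D.map (η x).hom).unop =
      𝟙 ((D.obj ((D.obj ((D.obj x).unop)).unop)).unop)

variable {C : Type u} [Category.{v} C]

/-- A Hermitian object of an anti-involutive category: an object `x` together with an
isomorphism `h : x† ≅ x` such that `η x ∘ h† = h`. -/
structure HermObj (A : AntiInvCat C) where
  /-- The underlying object. -/
  x : C
  /-- The Hermitian pairing `h : x† ≅ x`. -/
  h : (A.D.obj x).unop ≅ x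
  /-- Compatibility: `η x ∘ h† = h`. -/
  compat : (A.D.map h.hom).unop ≫ (A.η x).hom = h.hom

/-- The Hermitian category `Herm(C)`: objects are Hermitian objects, morphisms are the
morphisms of `C` between underlying objects. -/
instance HermObj.category (A : AntiInvCat C) : Category (HermObj A) where
  Hom a b := a.x ⟶ b.x
  id a := 𝟙 a.x
  comp f g := f ≫ g

/-- The dagger of a morphism `f : (x,h) ⟶ (y,k)` of `Herm(C)`, namely
`f‡ := h ∘ f† ∘ k⁻¹ : y ⟶ x`. -/
def hermDag {A : AntiInvCat C} {a b : HermObj A} (f : a ⟶ b) : b ⟶ a :=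
  (b.h.inv ≫ (A.D.map (show a.x ⟶ b.x from f)).unop ≫ a.h.hom : b.x ⟶ a.x)

/-- The forgetful functor `Herm(C) ⥤ C`, sending `(x,h)` to `x` and acting as the
identity on morphisms. -/
def hermForget (A : AntiInvCat C) : HermObj A ⥤ C where
  obj a := a.x
  map f := f

/-- The Hermitian category of an anti-involutive category, equipped with the operation
`f ↦ f‡ = h ∘ f† ∘ k⁻¹`, is a dagger category: identities are fixed, composition is
reversed, and the operation is involutive. In particular `‡` is the identity on
objects. -/
theorem hermDag_is_dagger (A : AntiInvCat C) :
    (∀ a : HermObj A, hermDag (𝟙 a) = 𝟙 a) ∧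
    (∀ {a b c : HermObj A} (f : a ⟶ b) (g : b ⟶ c),
      hermDag (f ≫ g) = hermDag g ≫ hermDag f) ∧
    (∀ {a b : HermObj A} (f : a ⟶ b), hermDag (hermDag f) = f) := by
  refine ⟨fun a => ?_, fun {a b c} f g => ?_, fun {a b} f => ?_⟩
  · change a.h.inv ≫ (A.D.map (𝟙 a.x)).unop ≫ a.h.hom = 𝟙 a.x
    simp
  · have key : ∀ (f : a.x ⟶ b.x) (g : b.x ⟶ c.x),
        c.h.inv ≫ (A.D.map (f ≫ g)).unop ≫ a.h.hom =
        (c.h.inv ≫ (A.D.map g).unop ≫ b.h.hom) ≫ (b.h.inv ≫ (A.D.map f).unop ≫ a.h.hom) := by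
      intro f g
      simp
    exact key f g
  · have key : ∀ (f : a.x ⟶ b.x),
        a.h.inv ≫ (A.D.map (b.h.inv ≫ (A.D.map f).unop ≫ a.h.hom)).unop ≫ b.h.hom = f := by
      intro f
      have e : (A.D.map b.h.inv).unop ≫ b.h.hom = (A.η b.x).hom := by
        conv_lhs => rw [← b.compat]
        rw [← Category.assoc, ← unop_comp, ← A.D.map_comp, b.h.hom_inv_id]
        simp
      rw [A.D.map_comp, A.D.map_comp, unop_comp, unop_comp, Category.assoc, Category.assoc, e,
        ← A.η_nat f, ← Category.assoc (A.D.map a.h.hom).unop, a.compat, Iso.inv_hom_id_assoc]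
    exact key f
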